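/- arXiv:1503.00528 — 2 statements merged into one kernel-verified Lean document; each statement's English description precedes it below -/
import Mathlib

section
/- Let d ≥ 2, let a : Fin d → ℝ satisfy a i ≥ 0 for all i, and let x ∈ ℝ. Let S ∈ Matrix (Fin d) (Fin d) ℂ be the cyclic shift matrix defined by S.mulVec eᵢ = e_{i+1 mod d} on the standard basis, let D = diagonal (fun i => (a i : ℂ)), and define W̃ ∈ Matrix (Fin d × Fin d) (Fin d × Fin d) ℂ by W̃ = Σ_{i ≠ j} x • (E i j ⊗ₖ E i j) + Σᵢ E i i ⊗ₖ (Sⁱ · D · (Sⁱ)ᴴ), where E i j is the standard matrix unit. Then W̃ is positive semidefinite if and only if the d×d matrix A with all diagonal entries equal to a 0 and all off-diagonal entries equal to x is positive semidefinite, equivalently if and only if −(a 0)/(d−1) ≤ x ≤ a 0. -/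
open Matrix Kronecker ComplexOrder

theorem choi_aux_smul_one (n : ℕ) (i : Fin (n + 2)) : (i : ℕ) • (1 : Fin (n + 2)) = i := by
  open Fin.CommRing in
  rw [nsmul_one]
  exact Fin.cast_val_eq_self i

theorem choi_aux_pow (n : ℕ) (S : Matrix (Fin (n + 2)) (Fin (n + 2)) ℂ)
    (hS : ∀ i, S.mulVec (Pi.single i 1) = Pi.single (i + 1) 1) (m : ℕ) :
    ∀ j, (S ^ m).mulVec (Pi.single j 1) = Pi.single (j + m • 1) 1 := by
  induction m with
  | zero => intro j; simp only [pow_zero, one_mulVec, zero_nsmul, add_zero]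
  | succ m ih =>
    intro j
    rw [pow_succ, ← Matrix.mulVec_mulVec, hS, ih, succ_nsmul']
    congr 1
    abel

theorem choi_aux_entry (n : ℕ) (S : Matrix (Fin (n + 2)) (Fin (n + 2)) ℂ)
    (hS : ∀ i, S.mulVec (Pi.single i 1) = Pi.single (i + 1) 1) (i k j : Fin (n + 2)) :
    (S ^ (i : ℕ)) k j = if j = k - i then 1 else 0 := by
  have h := congrFun (choi_aux_pow n S hS i j) k
  rw [choi_aux_smul_one] at h
  simp only [mulVec_single_one, Matrix.col_apply, Pi.single_apply] at h
  rw [h]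
  simp only [eq_sub_iff_add_eq, eq_comm]

theorem choi_aux_conj (n : ℕ) (S : Matrix (Fin (n + 2)) (Fin (n + 2)) ℂ)
    (hS : ∀ i, S.mulVec (Pi.single i 1) = Pi.single (i + 1) 1) (a : Fin (n + 2) → ℝ)
    (i : Fin (n + 2)) :
    S ^ (i : ℕ) * Matrix.diagonal (fun i => (a i : ℂ)) * (S ^ (i : ℕ))ᴴ =
      Matrix.diagonal (fun k => (a (k - i) : ℂ)) := by
  ext k l
  rw [Matrix.mul_apply]
  simp only [Matrix.mul_diagonal, Matrix.conjTranspose_apply, choi_aux_entry n S hS]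
  simp only [ite_mul, one_mul, zero_mul, Finset.sum_ite_eq', Finset.mem_univ, if_true,
    Matrix.diagonal_apply, sub_left_inj]
  split_ifs <;> simp

/-- The matrix with constant diagonal and constant off-diagonal entries. -/
def choiAuxMat (𝕜 : Type*) [RCLike 𝕜] (n : ℕ) (b x : ℝ) :
    Matrix (Fin (n + 2)) (Fin (n + 2)) 𝕜 :=
  Matrix.of fun i j => if i = j then (b : 𝕜) else (x : 𝕜)

theorem choi_aux_mat (𝕜 : Type*) [RCLike 𝕜] (n : ℕ) (b x : ℝ) :
    (choiAuxMat 𝕜 n b x).PosSemidef ↔ (0 ≤ b + (n + 1) * x ∧ x ≤ b) := by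
  have two : ((2 : ℝ) : 𝕜) = 2 := RCLike.ofReal_ofNat 2
  constructor
  · intro h
    constructor
    · have h1 := h.dotProduct_mulVec_nonneg (fun _ => 1)
      have h2 : star (fun _ : Fin (n + 2) => (1 : 𝕜)) ⬝ᵥ (choiAuxMat 𝕜 n b x *ᵥ fun _ => 1)
          = (((n + 2) * (b + (n + 1) * x) : ℝ) : 𝕜) := by
        have h3 : ∀ i j : Fin (n + 2), (if i = j then (b : 𝕜) else (x : 𝕜)) =
            x + (if i = j then (b - x : 𝕜) else 0) := by
          intro i j; split_ifs <;> ring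
        simp [choiAuxMat, dotProduct, mulVec, h3, Finset.sum_add_distrib, two]
        ring
      rw [h2, RCLike.ofReal_nonneg] at h1
      exact nonneg_of_mul_nonneg_right h1 (by positivity)
    · have h1 := h.dotProduct_mulVec_nonneg (Pi.single 0 1 - Pi.single 1 1)
      have h2 : star (Pi.single 0 1 - Pi.single 1 1 : Fin (n + 2) → 𝕜) ⬝ᵥ
          (choiAuxMat 𝕜 n b x *ᵥ (Pi.single 0 1 - Pi.single 1 1))
          = ((2 * (b - x) : ℝ) : 𝕜) := by
        simp [choiAuxMat, mulVec_sub, Pi.star_single, sub_dotProduct, two]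
        ring
      rw [h2, RCLike.ofReal_nonneg] at h1
      linarith
  · rintro ⟨h1, h2⟩
    let J : Matrix (Fin (n + 2)) (Fin (n + 2)) 𝕜 := Matrix.of fun _ _ => (((n : ℝ) + 2)⁻¹ : ℝ)
    have hn : ((n : 𝕜) + 2) ≠ 0 := by
      have : ((n + 2 : ℕ) : 𝕜) ≠ 0 := Nat.cast_ne_zero.mpr (by omega)
      exact_mod_cast this
    have hJH : Jᴴ = J := by
      ext i j; simp [J]
    have hJJ : J * J = J := by
      ext i j
      simp [J, Matrix.mul_apply, two]
      field_simp
    have hJ : J.PosSemidef := by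
      have := Matrix.posSemidef_conjTranspose_mul_self J
      rwa [hJH, hJJ] at this
    have hP : (1 - J).PosSemidef := by
      have := Matrix.posSemidef_conjTranspose_mul_self (1 - J)
      rw [conjTranspose_sub, hJH, conjTranspose_one] at this
      have h3 : (1 - J) * (1 - J) = 1 - J := by
        rw [sub_mul, one_mul, mul_sub, mul_one, hJJ, sub_self, sub_zero]
      rwa [h3] at this
    have e : choiAuxMat 𝕜 n b x =
        ((b - x : ℝ) : 𝕜) • (1 - J) + ((b + (n + 1) * x : ℝ) : 𝕜) • J := by
      ext i j
      simp [choiAuxMat, J, Matrix.one_apply, two]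
      split_ifs <;> field_simp <;> ring
    rw [e]
    exact (hP.smul (RCLike.ofReal_nonneg.mpr (by linarith))).add
      (hJ.smul (RCLike.ofReal_nonneg.mpr h1))

theorem choi_aux_W (n : ℕ) (a : Fin (n + 2) → ℝ) (ha : ∀ i, 0 ≤ a i) (x : ℝ)
    (W : Matrix (Fin (n + 2) × Fin (n + 2)) (Fin (n + 2) × Fin (n + 2)) ℂ)
    (hW : ∀ i k j l, W (i, k) (j, l) = (if i ≠ j ∧ i = k ∧ j = l then (x : ℂ) else 0) +
      if i = j ∧ k = l then (a (k - i) : ℂ) else 0) :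
    W.PosSemidef ↔ (choiAuxMat ℂ n (a 0) x).PosSemidef := by
  constructor
  · intro h
    have h1 := h.submatrix (fun i : Fin (n + 2) => (i, i))
    convert h1 using 1
    ext i j
    simp only [choiAuxMat, Matrix.submatrix_apply, hW, Matrix.of_apply]
    by_cases hij : i = j <;> simp [hij]
  · intro h
    let V : Matrix (Fin (n + 2) × Fin (n + 2)) (Fin (n + 2)) ℂ :=
      Matrix.of fun p i => if i = p.1 then (if p.1 = p.2 then 1 else 0) else 0
    have hVC : ∀ p i, (V * choiAuxMat ℂ n (a 0) x) p i =
        (if p.1 = p.2 then 1 else 0) * choiAuxMat ℂ n (a 0) x p.1 i := by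
      intro p i
      rw [Matrix.mul_apply, Finset.sum_eq_single p.1]
      · simp [V]
      · intro q _ hq
        simp [V, hq]
      · simp
    have hVCV : ∀ p q, (V * choiAuxMat ℂ n (a 0) x * Vᴴ) p q =
        (if p.1 = p.2 then 1 else 0) * choiAuxMat ℂ n (a 0) x p.1 q.1 *
          (if q.1 = q.2 then 1 else 0) := by
      intro p q
      rw [Matrix.mul_apply, Finset.sum_eq_single q.1]
      · rw [hVC]
        by_cases hq : q.1 = q.2 <;> simp [V, hq]
      · intro i _ hi
        simp [V, hi]
      · simp
    have h1 := h.mul_mul_conjTranspose_same V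
    have h2 : (Matrix.diagonal (fun p : Fin (n + 2) × Fin (n + 2) =>
        if p.1 = p.2 then (0 : ℂ) else (a (p.2 - p.1) : ℂ))).PosSemidef := by
      apply Matrix.PosSemidef.diagonal
      intro p
      simp only [Pi.zero_apply]
      split_ifs
      · exact le_rfl
      · exact_mod_cast ha _
    convert h1.add h2 using 1
    ext ⟨i, k⟩ ⟨j, l⟩
    rw [hW, Matrix.add_apply, hVCV, Matrix.diagonal_apply]
    simp only [choiAuxMat, Matrix.of_apply, Prod.mk.injEq]
    clear hW hVC hVCV h h1 h2
    by_cases h1 : i = j <;> by_cases h2 : i = k <;> by_cases h3 : j = l <;> by_cases h4 : k = l <;>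
      simp_all

/-- The operator `W̃ = Σ_{i≠j} x • (E i j ⊗ₖ E i j) + Σᵢ E i i ⊗ₖ (Sⁱ D (Sⁱ)ᴴ)` built from
the cyclic shift `S` and diagonal `D = diag(a)`, `a ≥ 0`, is positive semidefinite iff
the matrix with diagonal `a 0` and off-diagonal `x` is, iff `-(a 0)/(d-1) ≤ x ≤ a 0`. -/
theorem generalized_choi_positivity (d : ℕ) (hd : 2 ≤ d)
    (a : Fin d → ℝ) (ha : ∀ i, 0 ≤ a i) (x : ℝ)
    (S : Matrix (Fin d) (Fin d) ℂ)
    (hS : ∀ i : Fin d, S.mulVec (Pi.single i 1) = Pi.single (i + ⟨1, by omega⟩) 1)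
    (D : Matrix (Fin d) (Fin d) ℂ)
    (hD : D = Matrix.diagonal fun i => (a i : ℂ))
    (Wt : Matrix (Fin d × Fin d) (Fin d × Fin d) ℂ)
    (hWt : Wt =
      (∑ i : Fin d, ∑ j : Fin d, if i ≠ j then
          (x : ℂ) • (Matrix.single i j 1 ⊗ₖ Matrix.single i j 1) else 0)
      + ∑ i : Fin d,
          Matrix.single i i 1 ⊗ₖ (S ^ (i : ℕ) * D * (S ^ (i : ℕ))ᴴ))
    (A : Matrix (Fin d) (Fin d) ℝ)
    (hA : A = Matrix.of fun i j => if i = j then a ⟨0, by omega⟩ else x) :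
    (Wt.PosSemidef ↔ A.PosSemidef) ∧
    (Wt.PosSemidef ↔ (-(a ⟨0, by omega⟩) / ((d : ℝ) - 1) ≤ x ∧ x ≤ a ⟨0, by omega⟩)) := by
  obtain ⟨n, rfl⟩ : ∃ n, d = n + 2 := ⟨d - 2, by omega⟩
  have hS' : ∀ i, S.mulVec (Pi.single i 1) = Pi.single (i + 1) 1 := hS
  have hAm : A = choiAuxMat ℝ n (a 0) x := by
    rw [hA]; rfl
  have hWm := choi_aux_W n a ha x Wt (by
    intro i k j l
    rw [hWt, hD]
    simp only [choi_aux_conj n S hS' a, Matrix.add_apply, Matrix.sum_apply]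
    congr 1
    · have h : ∀ p q : Fin (n + 2), (if p ≠ q then
          (x : ℂ) • (Matrix.single p q (1 : ℂ) ⊗ₖ Matrix.single p q (1 : ℂ)) else 0) (i, k) (j, l) =
          if p = i then (if q = j then
            (if i ≠ j ∧ i = k ∧ j = l then (x : ℂ) else 0) else 0) else 0 := by
        intro p q
        by_cases h3 : p = q
        · subst h3
          rw [if_neg (by simp), Matrix.zero_apply]
          split_ifs with h1 h2 h4
          · exact absurd (h1.symm.trans h2) h4.1
          all_goals rfl
        · rw [if_pos h3, Matrix.smul_apply, Matrix.kroneckerMap_apply, Matrix.single_apply,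
            Matrix.single_apply]
          by_cases h1 : p = i
          · by_cases h2 : q = j
            · subst h1 h2
              by_cases h4 : p = k <;> by_cases h5 : q = l <;> simp [h3, h4, h5]
              rw [← h4, ← h5]
              exact fun h6 => absurd h6 h3
            · simp [h2]
          · simp [h1]
      simp only [h]
      rw [Finset.sum_eq_single i]
      · rw [Finset.sum_eq_single j]
        · rw [if_pos rfl, if_pos rfl]
        · intro q _ hq
          rw [if_pos rfl, if_neg hq]
        · exact fun h6 => absurd (Finset.mem_univ _) h6
      · intro p _ hp
        simp only [if_neg hp, Finset.sum_const_zero]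
      · exact fun h6 => absurd (Finset.mem_univ _) h6
    · simp only [Matrix.kroneckerMap_apply, Matrix.single_apply, Matrix.diagonal_apply]
      rw [Finset.sum_eq_single i]
      · by_cases h1 : i = j <;> by_cases h2 : k = l <;> simp [h1, h2]
      · intro p _ hp
        simp [hp]
      · simp)
  have hr : (0 ≤ a 0 + (n + 1) * x ∧ x ≤ a 0) ↔
      (-(a ⟨0, by omega⟩) / (((n + 2 : ℕ) : ℝ) - 1) ≤ x ∧ x ≤ a ⟨0, by omega⟩) := by
    change _ ↔ (-(a 0) / (((n + 2 : ℕ) : ℝ) - 1) ≤ x ∧ x ≤ a 0)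
    have e : (((n + 2 : ℕ) : ℝ) - 1) = n + 1 := by push_cast; ring
    rw [e, div_le_iff₀ (by positivity)]
    constructor <;> rintro ⟨h1, h2⟩ <;> exact ⟨by linarith, h2⟩
  rw [hWm, hAm, ← hr, choi_aux_mat, choi_aux_mat]
  exact ⟨Iff.rfl, Iff.rfl⟩
end

section
/- Let W_Ch ∈ Matrix (Fin 3 × Fin 3) (Fin 3 × Fin 3) ℂ be the Choi-type witness defined by W_Ch((i,k),(j,l)) = 1 if i = j, k = l, i ≠ k; W_Ch((i,k),(j,l)) = −1 if i = k, j = l, i ≠ j; and 0 otherwise. Then (1 ⊗ R⁻¹)W_Ch = Σ_{i,j} E i j ⊗ₖ E i j, this matrix is positive semidefinite, and W_Ch itself is Hermitian but not positive semidefinite. -/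
open Matrix Kronecker ComplexOrder

/-- The inverse reduction map for `d = 3`: `R⁻¹(A) = (trace A / 2) • 1 - A`. -/
noncomputable def Rinv3 (A : Matrix (Fin 3) (Fin 3) ℂ) : Matrix (Fin 3) (Fin 3) ℂ :=
  (A.trace / 2) • (1 : Matrix (Fin 3) (Fin 3) ℂ) - A

/-- The map `1 ⊗ Λ`, defined entrywise by
`((1 ⊗ Λ) M) ((i,k),(j,l)) = (Λ M⁽ⁱʲ⁾) (k,l)` where `M⁽ⁱʲ⁾ (k,l) = M ((i,k),(j,l))`. -/
noncomputable def oneTensor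
    (Λ : Matrix (Fin 3) (Fin 3) ℂ → Matrix (Fin 3) (Fin 3) ℂ)
    (M : Matrix (Fin 3 × Fin 3) (Fin 3 × Fin 3) ℂ) :
    Matrix (Fin 3 × Fin 3) (Fin 3 × Fin 3) ℂ :=
  Matrix.of fun p q => Λ (Matrix.of fun k l => M (p.1, k) (q.1, l)) p.2 q.2

/-- The Choi-type entanglement witness. -/
def WCh : Matrix (Fin 3 × Fin 3) (Fin 3 × Fin 3) ℂ :=
  Matrix.of fun p q =>
    if p.1 = q.1 ∧ p.2 = q.2 ∧ p.1 ≠ p.2 then 1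
    else if p.1 = p.2 ∧ q.1 = q.2 ∧ p.1 ≠ q.1 then -1 else 0

/-- The image of the witness is the rank-one matrix of the unnormalized maximally entangled
vector. -/
theorem oneTensor_WCh_apply (i k j l : Fin 3) :
    oneTensor Rinv3 WCh (i, k) (j, l) = if i = k ∧ j = l then 1 else 0 := by
  simp only [oneTensor, Rinv3, WCh, Matrix.of_apply, Matrix.sub_apply,
    Matrix.smul_apply, Matrix.trace, Matrix.diag, Fin.sum_univ_three, Matrix.one_apply]
  revert i k j l
  simp only [Fin.forall_fin_succ]
  norm_num [Fin.ext_iff]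

theorem sum_single_kron_apply (i k j l : Fin 3) :
    (∑ a : Fin 3, ∑ b : Fin 3, (Matrix.single a b 1 : Matrix (Fin 3) (Fin 3) ℂ) ⊗ₖ
      (Matrix.single a b 1 : Matrix (Fin 3) (Fin 3) ℂ)) (i, k) (j, l) =
      if i = k ∧ j = l then 1 else 0 := by
  simp only [Matrix.sum_apply, Matrix.kronecker, Matrix.kroneckerMap_apply, Matrix.single,
    Matrix.of_apply]
  rw [Finset.sum_eq_single i, Finset.sum_eq_single j]
  · simp
  · intro b _ hb
    simp [hb]
  · simp
  · intro b _ hb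
    simp [hb]
  · simp

/-- `(1 ⊗ R⁻¹) W_Ch = Σ_{i,j} E i j ⊗ₖ E i j` is positive semidefinite, while `W_Ch`
itself is Hermitian but not positive semidefinite. -/
theorem choi_witness_inverse_reduction :
    (oneTensor Rinv3 WCh =
      ∑ i : Fin 3, ∑ j : Fin 3,
        Matrix.single i j 1 ⊗ₖ Matrix.single i j 1) ∧
    (oneTensor Rinv3 WCh).PosSemidef ∧
    WChᴴ = WCh ∧ ¬ WCh.PosSemidef := by
  refine ⟨?_, ?_, ?_, ?_⟩
  · ext ⟨i, k⟩ ⟨j, l⟩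
    rw [oneTensor_WCh_apply, sum_single_kron_apply]
  · have h2 : oneTensor Rinv3 WCh =
        vecMulVec (fun p : Fin 3 × Fin 3 => if p.1 = p.2 then (1 : ℂ) else 0)
          (star (fun p : Fin 3 × Fin 3 => if p.1 = p.2 then (1 : ℂ) else 0)) := by
      ext ⟨i, k⟩ ⟨j, l⟩
      rw [oneTensor_WCh_apply, Matrix.vecMulVec_apply, Pi.star_apply]
      by_cases h : i = k <;> by_cases h' : j = l <;> simp [h, h']
    rw [h2]
    exact Matrix.posSemidef_vecMulVec_self_star _
  · ext ⟨i, k⟩ ⟨j, l⟩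
    simp only [WCh, Matrix.conjTranspose_apply, Matrix.of_apply, apply_ite star, star_one,
      star_neg, star_zero]
    grind
  · intro h
    have h3 := h.dotProduct_mulVec_nonneg
      (fun p : Fin 3 × Fin 3 => if p.1 = p.2 then (1 : ℂ) else 0)
    simp [dotProduct, mulVec, Fintype.sum_prod_type, Fin.sum_univ_three, WCh] at h3
    norm_num [Complex.le_def] at h3
end
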